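/- arXiv:0812.1776 — 2 statements merged into one kernel-verified Lean document; each statement's English description precedes it below -/
import Mathlib

section
/- Let K be a field of characteristic zero, R = K[x₁,…,xₙ], and I ⊆ R an ideal. For every point a ∈ Kⁿ and every integer c ≥ 1, one has I ⊆ m_aᶜ if and only if Δ^{c-1}(I) ⊆ m_a. (That is, the locus of points where the order of I is at least c is the vanishing locus of the iterated derivative ideal Δ^{c-1}(I).) -/
open MvPolynomial

/-- The derivative ideal Δ(I): the ideal generated by all elements of `I`
together with all first-order partial derivatives of elements of `I`. -/
noncomputable def Delta {K : Type*} [Field K] {n : ℕ}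
    (I : Ideal (MvPolynomial (Fin n) K)) : Ideal (MvPolynomial (Fin n) K) :=
  Ideal.span ((I : Set (MvPolynomial (Fin n) K)) ∪
    {g | ∃ f ∈ I, ∃ j : Fin n, g = pderiv j f})

namespace MvPolynomial

section Translate

variable {σ R : Type*} [CommRing R]

/-- The automorphism of `MvPolynomial σ R` sending `X i` to `X i + C (a i)`. -/
noncomputable def translate (a : σ → R) : MvPolynomial σ R ≃ₐ[R] MvPolynomial σ R :=
  AlgEquiv.ofAlgHom (aeval fun i => X i + C (a i)) (aeval fun i => X i - C (a i))
    (by ext i : 1; simp [algebraMap_eq])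
    (by ext i : 1; simp [algebraMap_eq])

@[simp]
lemma translate_X (a : σ → R) (i : σ) : translate a (X i) = X i + C (a i) := by
  simp [translate]

@[simp]
lemma translate_C (a : σ → R) (r : R) : translate a (C r) = C r :=
  (translate a).commutes r

lemma constantCoeff_translate (a : σ → R) (f : MvPolynomial σ R) :
    constantCoeff (translate a f) = eval a f := by
  induction f using MvPolynomial.induction_on with
  | C r => simp
  | add p q hp hq => simp [hp, hq]
  | mul_X p i hp => simp [hp]

lemma pderiv_translate (a : σ → R) (i : σ) (f : MvPolynomial σ R) :
    pderiv i (translate a f) = translate a (pderiv i f) := by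
  classical
  induction f using MvPolynomial.induction_on with
  | C r => simp
  | add p q hp hq => simp [hp, hq]
  | mul_X p j hp =>
    rcases eq_or_ne j i with rfl | h
    · simp [hp]
    · simp [hp, pderiv_X_of_ne h]

lemma ker_eval_eq_comap_translate (a : σ → R) :
    RingHom.ker (eval a) = (idealOfVars σ R).comap (translate a).toRingEquiv := by
  ext f
  rw [RingHom.mem_ker, Ideal.mem_comap, ← pow_one (idealOfVars σ R), mem_pow_idealOfVars_iff',
    ← constantCoeff_translate]
  simp [constantCoeff_eq, Finsupp.degree_eq_zero_iff]

lemma mem_ker_eval_pow_iff (a : σ → R) (c : ℕ) (f : MvPolynomial σ R) :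
    f ∈ RingHom.ker (eval a) ^ c ↔ translate a f ∈ idealOfVars σ R ^ c := by
  rw [ker_eval_eq_comap_translate, ← Ideal.map_symm, ← Ideal.map_pow, Ideal.map_symm,
    Ideal.mem_comap]
  rfl

end Translate

section PDeriv

variable {σ R : Type*}

lemma pderiv_mem_pow_idealOfVars [CommSemiring R] {c : ℕ} {f : MvPolynomial σ R}
    (hf : f ∈ idealOfVars σ R ^ (c + 1)) (i : σ) : pderiv i f ∈ idealOfVars σ R ^ c := by
  rw [mem_pow_idealOfVars_iff'] at hf ⊢
  intro x hx
  rw [coeff_pderiv, hf _ (by simpa using hx), zero_mul]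

lemma mem_pow_idealOfVars_succ_of_pderiv [CommRing R] [NoZeroDivisors R] [CharZero R] {c : ℕ}
    (hc : c ≠ 0) {f : MvPolynomial σ R} (hf : f ∈ idealOfVars σ R ^ c)
    (hd : ∀ i, pderiv i f ∈ idealOfVars σ R ^ c) : f ∈ idealOfVars σ R ^ (c + 1) := by
  simp only [mem_pow_idealOfVars_iff'] at hf hd ⊢
  intro x hx
  rcases (Nat.lt_succ_iff.mp hx).lt_or_eq with hlt | heq
  · exact hf x hlt
  have hx0 : x ≠ 0 := by
    rintro rfl
    exact hc (by simpa using heq.symm)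
  obtain ⟨i, hi⟩ := Finsupp.ne_iff.mp hx0
  obtain ⟨y, rfl⟩ : ∃ y, x = y + Finsupp.single i 1 :=
    ⟨x - Finsupp.single i 1, (tsub_add_cancel_of_le
      (Finsupp.single_le_iff.mpr (Nat.one_le_iff_ne_zero.mpr hi))).symm⟩
  have hy : y.degree + 1 = c := by simpa using heq
  have h := hd i y (by lia)
  rw [coeff_pderiv] at h
  exact (mul_eq_zero.mp h).resolve_right (Nat.cast_add_one_ne_zero _)

lemma pderiv_mem_ker_eval_pow [CommRing R] {a : σ → R} {c : ℕ} {f : MvPolynomial σ R}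
    (hf : f ∈ RingHom.ker (eval a) ^ (c + 1)) (i : σ) :
    pderiv i f ∈ RingHom.ker (eval a) ^ c := by
  rw [mem_ker_eval_pow_iff] at hf ⊢
  rw [← pderiv_translate]
  exact pderiv_mem_pow_idealOfVars hf i

lemma mem_ker_eval_pow_succ_of_pderiv [CommRing R] [NoZeroDivisors R] [CharZero R]
    {a : σ → R} {c : ℕ} (hc : c ≠ 0) {f : MvPolynomial σ R} (hf : f ∈ RingHom.ker (eval a) ^ c)
    (hd : ∀ i, pderiv i f ∈ RingHom.ker (eval a) ^ c) : f ∈ RingHom.ker (eval a) ^ (c + 1) := by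
  simp only [mem_ker_eval_pow_iff, ← pderiv_translate] at hf hd ⊢
  exact mem_pow_idealOfVars_succ_of_pderiv hc hf hd

end PDeriv

end MvPolynomial

lemma Delta_le_iff {K : Type*} [Field K] {n : ℕ} {I J : Ideal (MvPolynomial (Fin n) K)} :
    Delta I ≤ J ↔ I ≤ J ∧ ∀ f ∈ I, ∀ j, pderiv j f ∈ J := by
  rw [Delta, Ideal.span_le, Set.union_subset_iff]
  refine and_congr Iff.rfl ⟨fun h f hf j => h ⟨f, hf, j, rfl⟩, ?_⟩
  rintro h _ ⟨f, hf, j, rfl⟩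
  exact h f hf j

lemma le_ker_eval_pow_succ_iff {K : Type*} [Field K] [CharZero K] {n : ℕ}
    (I : Ideal (MvPolynomial (Fin n) K)) (a : Fin n → K) {c : ℕ} (hc : c ≠ 0) :
    I ≤ RingHom.ker (eval a) ^ (c + 1) ↔ Delta I ≤ RingHom.ker (eval a) ^ c := by
  rw [Delta_le_iff]
  exact ⟨fun h => ⟨h.trans (Ideal.pow_le_pow_right c.le_succ),
      fun f hf => pderiv_mem_ker_eval_pow (h hf)⟩,
    fun h f hf => mem_ker_eval_pow_succ_of_pderiv hc (h.1 hf) (h.2 f hf)⟩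

theorem order_ge_c_iff_delta_vanishes
    {K : Type*} [Field K] [CharZero K] {n : ℕ}
    (I : Ideal (MvPolynomial (Fin n) K)) (a : Fin n → K) (c : ℕ) (hc : 1 ≤ c) :
    I ≤ (RingHom.ker (eval a)) ^ c ↔
      Delta^[c - 1] I ≤ RingHom.ker (eval a) := by
  obtain ⟨k, rfl⟩ := Nat.exists_eq_add_of_le' hc
  rw [Nat.add_sub_cancel]
  clear hc
  induction k generalizing I with
  | zero => simp
  | succ k ih =>
    rw [le_ker_eval_pow_succ_iff I a k.succ_ne_zero, ih, Function.iterate_succ_apply]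
end

section
/- Let ψ be the ℂ-algebra endomorphism of ℂ[x,y,z,w,v] with ψ(x) = xy, ψ(y) = y, ψ(z) = yz, ψ(w) = yw, ψ(v) = yv (the y-chart of the blow-up of ℂ⁵ at the origin), and let T = ⟨ψ(z² + x³y³), ψ(w⁵ + x⁵ + v³y²)⟩ be the total transform of I = ⟨z² + x³y³, w⁵ + x⁵ + v³y²⟩. Then the saturation of T with respect to y equals ⟨z² + x³y⁴, w⁵ + x⁵ + v³⟩; i.e., for every f ∈ ℂ[x,y,z,w,v], (∃ n ≥ 0 with yⁿ·f ∈ T) if and only if f ∈ ⟨z² + x³y⁴, w⁵ + x⁵ + v³⟩. -/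
open MvPolynomial

noncomputable def x : MvPolynomial (Fin 5) ℂ := X 0
noncomputable def y : MvPolynomial (Fin 5) ℂ := X 1
noncomputable def z : MvPolynomial (Fin 5) ℂ := X 2
noncomputable def w : MvPolynomial (Fin 5) ℂ := X 3
noncomputable def v : MvPolynomial (Fin 5) ℂ := X 4

/-- The y-chart of the blow-up of ℂ⁵ at the origin:
`x ↦ xy, y ↦ y, z ↦ yz, w ↦ yw, v ↦ yv`. -/
noncomputable def psi : MvPolynomial (Fin 5) ℂ →ₐ[ℂ] MvPolynomial (Fin 5) ℂ :=
  aeval ![x * y, y, y * z, y * w, y * v]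

/-- A polynomial is congruent modulo `X i` to its restriction to the hyperplane `X i = 0`. -/
theorem X_dvd_sub_aeval_update_zero (i : Fin 5) (f : MvPolynomial (Fin 5) ℂ) :
    X i ∣ f - aeval (Function.update (X : Fin 5 → MvPolynomial (Fin 5) ℂ) i 0) f := by
  induction f using MvPolynomial.induction_on with
  | C a => simp [algebraMap_eq]
  | add p q hp hq =>
    rw [map_add, add_sub_add_comm]
    exact dvd_add hp hq
  | mul_X p j hp =>
    rw [map_mul, aeval_X]
    by_cases hj : j = i
    · subst hj
      simp
    · rw [Function.update_of_ne hj, ← sub_mul]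
      exact hp.mul_right _

theorem psi_first_generator :
    psi (z ^ 2 + x ^ 3 * y ^ 3) = y ^ 2 * (z ^ 2 + x ^ 3 * y ^ 4) := by
  simp [psi, x, y, z]
  ring

theorem psi_second_generator :
    psi (w ^ 5 + x ^ 5 + v ^ 3 * y ^ 2) = y ^ 5 * (w ^ 5 + x ^ 5 + v ^ 3) := by
  simp [psi, x, y, w, v]
  ring

theorem z_not_dvd_second_generator : ¬ z ∣ w ^ 5 + x ^ 5 + v ^ 3 := by
  rintro ⟨c, hc⟩
  have h := congrArg (aeval (![1, 0, 0, 0, 0] : Fin 5 → ℂ)) hc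
  simp [x, z, w, v] at h

/-- The exceptional equation `y` is a nonzerodivisor modulo the strict transform. -/
theorem mem_of_y_mul_mem {f : MvPolynomial (Fin 5) ℂ}
    (h : y * f ∈ Ideal.span {z ^ 2 + x ^ 3 * y ^ 4, w ^ 5 + x ^ 5 + v ^ 3}) :
    f ∈ Ideal.span {z ^ 2 + x ^ 3 * y ^ 4, w ^ 5 + x ^ 5 + v ^ 3} := by
  have hy : y ≠ 0 := X_ne_zero 1
  have hz : Prime z := X_prime
  rw [Ideal.mem_span_pair] at h ⊢
  obtain ⟨a, b, hab⟩ := h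
  obtain ⟨a', ha⟩ := X_dvd_sub_aeval_update_zero 1 a
  obtain ⟨b', hb⟩ := X_dvd_sub_aeval_update_zero 1 b
  have h0 := congrArg
    (aeval (Function.update (X : Fin 5 → MvPolynomial (Fin 5) ℂ) 1 0)) hab
  set a₀ := aeval (Function.update (X : Fin 5 → MvPolynomial (Fin 5) ℂ) 1 0) a with haa
  set b₀ := aeval (Function.update (X : Fin 5 → MvPolynomial (Fin 5) ℂ) 1 0) b with hbb
  have h1 : a₀ * z ^ 2 + b₀ * (w ^ 5 + x ^ 5 + v ^ 3) = 0 := by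
    simp only [map_add, map_mul, map_pow, ← haa, ← hbb] at h0
    clear_value a₀ b₀
    simpa [x, y, z, w, v, Function.update_apply] using h0
  obtain ⟨c, hc⟩ : z ^ 2 ∣ b₀ :=
    hz.pow_dvd_of_dvd_mul_right 2 z_not_dvd_second_generator
      ⟨-a₀, by linear_combination h1⟩
  have ha₀ : a₀ = -c * (w ^ 5 + x ^ 5 + v ^ 3) := by
    apply mul_right_cancel₀ (pow_ne_zero 2 hz.ne_zero)
    rw [hc] at h1
    linear_combination h1
  change a - a₀ = y * a' at ha
  change b - b₀ = y * b' at hb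
  refine ⟨a', b' - c * x ^ 3 * y ^ 3, mul_left_cancel₀ hy ?_⟩
  linear_combination hab - (z ^ 2 + x ^ 3 * y ^ 4) * (ha + ha₀) -
    (w ^ 5 + x ^ 5 + v ^ 3) * (hb + hc)

/-- The strict transform of `⟨z² + x³y³, w⁵ + x⁵ + v³y²⟩` in the y-chart:
the saturation of the total transform with respect to `y` is
`⟨z² + x³y⁴, w⁵ + x⁵ + v³⟩`. -/
theorem strict_transform_y_chart (f : MvPolynomial (Fin 5) ℂ) :
    (∃ n : ℕ, y ^ n * f ∈
        Ideal.span {psi (z ^ 2 + x ^ 3 * y ^ 3),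
                    psi (w ^ 5 + x ^ 5 + v ^ 3 * y ^ 2)}) ↔
      f ∈ Ideal.span {z ^ 2 + x ^ 3 * y ^ 4, w ^ 5 + x ^ 5 + v ^ 3} := by
  rw [psi_first_generator, psi_second_generator]
  constructor
  · rintro ⟨n, hn⟩
    have hle : Ideal.span {y ^ 2 * (z ^ 2 + x ^ 3 * y ^ 4), y ^ 5 * (w ^ 5 + x ^ 5 + v ^ 3)} ≤
        Ideal.span {z ^ 2 + x ^ 3 * y ^ 4, w ^ 5 + x ^ 5 + v ^ 3} := by
      rw [Ideal.span_le, Set.pair_subset_iff]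
      exact ⟨Ideal.mul_mem_left _ _ (Ideal.subset_span (by simp)),
        Ideal.mul_mem_left _ _ (Ideal.subset_span (by simp))⟩
    replace hn := hle hn
    induction n with
    | zero => simpa using hn
    | succ n ih =>
      rw [pow_succ' y n, mul_assoc] at hn
      exact ih (mem_of_y_mul_mem hn)
  · intro h
    obtain ⟨a, b, rfl⟩ := Ideal.mem_span_pair.1 h
    exact ⟨5, Ideal.mem_span_pair.2 ⟨y ^ 3 * a, b, by ring⟩⟩
end
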